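/- Let L be a frame. Then L is infinitely De Morgan (IDM) if and only if L is both ⊥-scattered and infinitely extremally disconnected (IED). -/

import Mathlib

universe u

theorem Order.Frame.compl_iSup_eq {L : Type*} [Order.Frame L] {ι : Sort*} (a : ι → L) :
    (⨆ i, a i)ᶜ = ⨅ i, (a i)ᶜ :=
  eq_of_forall_le_iff fun b => by
    simp only [le_iInf_iff, le_compl_comm (a := b), iSup_le_iff]

/-- A frame is IDM iff it is `⊥`-scattered and IED. -/
theorem idm_iff_botScattered_and_ied {L : Type u} [Order.Frame L] :
    (∀ {ι : Type u} (a : ι → L), (⨅ i, a i)ᶜ ≤ ⨆ i, (a i)ᶜ) ↔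
      ((∀ {ι : Type u} (a : ι → L), (⨅ i, (a i)ᶜᶜ) ≤ (⨅ i, a i)ᶜᶜ) ∧
        (∀ {ι : Type u} (a : ι → L), (⨆ i, a i)ᶜᶜ ≤ ⨆ i, (a i)ᶜᶜ)) := by
  constructor
  · intro idm
    refine ⟨fun a => ?_, fun a => ?_⟩
    · rw [← Order.Frame.compl_iSup_eq]
      exact compl_le_compl (idm a)
    · rw [Order.Frame.compl_iSup_eq]
      exact idm fun i => (a i)ᶜ
  · rintro ⟨scattered, ied⟩ ι a
    calc (⨅ i, a i)ᶜ = (⨅ i, a i)ᶜᶜᶜ := (compl_compl_compl _).symm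
      _ ≤ (⨅ i, (a i)ᶜᶜ)ᶜ := compl_le_compl (scattered a)
      _ = (⨆ i, (a i)ᶜ)ᶜᶜ := by rw [Order.Frame.compl_iSup_eq]
      _ ≤ ⨆ i, (a i)ᶜᶜᶜ := ied fun i => (a i)ᶜ
      _ = ⨆ i, (a i)ᶜ := by simp only [compl_compl_compl]
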